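/- arXiv:2103.03346 — 5 statements merged into one kernel-verified Lean document; each statement's English description precedes it below -/
import Mathlib

section
/- Let m ≥ 2 be an integer number of machines. Let σ₂ be a feasible schedule on 2 machines that maximises F among all feasible schedules on 2 machines. Then for every feasible schedule σ^A on m machines whose on-time set satisfies J(σ₂) ⊆ J(σ^A), and for every feasible schedule σ on m machines, F(σ) ≤ (m/2)·F(σ^A). (In particular, any algorithm whose output schedule's on-time set contains the on-time set of an optimal 2-machine schedule has performance guarantee m/2 for maximising the total weight of on-time jobs.) -/
/-- A feasible schedule on `m` machines with deadline `D` for the job set `N`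
(UET jobs) subject to the conflict graph `G`: `S t` is the set of jobs processed
in time slot `[t-1, t]`; the slots are pairwise disjoint subsets of `N`, each of
cardinality at most `m`, and no two jobs in the same slot are in conflict. -/
def Feasible (N : Finset ℕ) (G : SimpleGraph ℕ) (m D : ℕ)
    (S : Fin D → Finset ℕ) : Prop :=
  (∀ t, S t ⊆ N) ∧
  (∀ t t' : Fin D, t ≠ t' → Disjoint (S t) (S t')) ∧
  (∀ t, (S t).card ≤ m) ∧
  (∀ t, ∀ a ∈ S t, ∀ b ∈ S t, ¬ G.Adj a b)

/-- The set `J(σ)` of on-time jobs of a schedule. -/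
def onTime {D : ℕ} (S : Fin D → Finset ℕ) : Finset ℕ :=
  Finset.univ.biUnion S

/-- The total weight `F(σ)` of on-time jobs. -/
noncomputable def Fval {D : ℕ} (w : ℕ → ℝ) (S : Fin D → Finset ℕ) : ℝ :=
  ∑ j ∈ onTime S, w j

/-- A set of at most `m ≥ 2` jobs has a subset of at most two jobs carrying at least
a `2 / m` fraction of its weight. -/
theorem exists_subset_card_le_two_sum_le {ι : Type*} [DecidableEq ι] (w : ι → ℝ) (s : Finset ι)
    (hw : ∀ j ∈ s, 0 ≤ w j) {m : ℕ} (hm : 2 ≤ m) (hs : s.card ≤ m) :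
    ∃ T ⊆ s, T.card ≤ 2 ∧ ∑ j ∈ s, w j ≤ ((m : ℝ) / 2) * ∑ j ∈ T, w j := by
  have hm' : (2 : ℝ) ≤ m := by exact_mod_cast hm
  rcases le_or_gt s.card 2 with hc | hc
  · exact ⟨s, subset_rfl, hc, le_mul_of_one_le_left (Finset.sum_nonneg hw) (by linarith)⟩
  obtain ⟨a, ha, hamax⟩ := s.exists_max_image w (Finset.card_pos.1 (by omega))
  have hca : (s.erase a).card = s.card - 1 := Finset.card_erase_of_mem ha
  obtain ⟨b, hb, hbmax⟩ := (s.erase a).exists_max_image w (Finset.card_pos.1 (by omega))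
  obtain ⟨hba, hbs⟩ := Finset.mem_erase.1 hb
  refine ⟨{a, b}, by simp [Finset.insert_subset_iff, ha, hbs], Finset.card_le_two, ?_⟩
  rw [Finset.sum_pair hba.symm, ← Finset.add_sum_erase s w ha]
  have hrest : ∑ j ∈ s.erase a, w j ≤ ((m : ℝ) - 1) * w b := by
    calc ∑ j ∈ s.erase a, w j ≤ (s.erase a).card • w b := Finset.sum_le_card_nsmul _ _ _ hbmax
      _ ≤ ((m : ℝ) - 1) * w b := by
        rw [nsmul_eq_mul]
        refine mul_le_mul_of_nonneg_right ?_ (hw b hbs)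
        have : (s.erase a).card + 1 ≤ m := by omega
        have : ((s.erase a).card : ℝ) + 1 ≤ m := by exact_mod_cast this
        linarith
  have hab := hamax b hbs
  nlinarith [mul_nonneg (sub_nonneg.2 hm') (sub_nonneg.2 hab)]

/-- The value of a feasible schedule is the sum of the weights of its slots. -/
theorem Feasible.Fval_eq_sum {N : Finset ℕ} {G : SimpleGraph ℕ} {m D : ℕ}
    {S : Fin D → Finset ℕ} (h : Feasible N G m D S) (w : ℕ → ℝ) :
    Fval w S = ∑ t, ∑ j ∈ S t, w j :=
  Finset.sum_biUnion fun t _ t' _ htt' => h.2.1 t t' htt'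

/-- Restricting every slot of a feasible schedule to a subset of size at most `k` gives a
feasible schedule on `k` machines. -/
theorem Feasible.of_subset {N : Finset ℕ} {G : SimpleGraph ℕ} {m k D : ℕ}
    {S T : Fin D → Finset ℕ} (h : Feasible N G m D S) (hT : ∀ t, T t ⊆ S t)
    (hk : ∀ t, (T t).card ≤ k) : Feasible N G k D T :=
  ⟨fun t => (hT t).trans (h.1 t),
    fun t t' htt' => (h.2.1 t t' htt').mono (hT t) (hT t'), hk,
    fun t a ha b hb => h.2.2.2 t a (hT t ha) b (hT t hb)⟩

/-- Any schedule `σ^A` on `m ≥ 2` machines whose on-time set contains the on-time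
set of an optimal 2-machine schedule `σ₂` has performance guarantee `m/2`:
`F(σ) ≤ (m/2)·F(σ^A)` for every feasible schedule `σ` on `m` machines. -/
theorem weight_le_half_m_of_contains_opt_two_machine
    (N : Finset ℕ) (G : SimpleGraph ℕ) (w : ℕ → ℝ)
    (hw : ∀ j ∈ N, 0 < w j) (m D : ℕ) (hm : 2 ≤ m) (hD : 1 ≤ D)
    (σ₂ : Fin D → Finset ℕ) (hσ₂ : Feasible N G 2 D σ₂)
    (hopt : ∀ σ' : Fin D → Finset ℕ, Feasible N G 2 D σ' → Fval w σ' ≤ Fval w σ₂)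
    (σA : Fin D → Finset ℕ) (hσA : Feasible N G m D σA)
    (hsub : onTime σ₂ ⊆ onTime σA)
    (σ : Fin D → Finset ℕ) (hσ : Feasible N G m D σ) :
    Fval w σ ≤ ((m : ℝ) / 2) * Fval w σA := by
  choose T hTsub hTcard hTsum using fun t =>
    exists_subset_card_le_two_sum_le w (σ t) (fun j hj => (hw j (hσ.1 t hj)).le) hm (hσ.2.2.1 t)
  have hT : Feasible N G 2 D T := hσ.of_subset hTsub hTcard
  have hσ₂A : Fval w σ₂ ≤ Fval w σA := by
    refine Finset.sum_le_sum_of_subset_of_nonneg hsub fun j hj _ => ?_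
    obtain ⟨t, -, ht⟩ := Finset.mem_biUnion.1 hj
    exact (hw j (hσA.1 t ht)).le
  calc Fval w σ = ∑ t, ∑ j ∈ σ t, w j := hσ.Fval_eq_sum w
    _ ≤ ∑ t, ((m : ℝ) / 2) * ∑ j ∈ T t, w j := Finset.sum_le_sum fun t _ => hTsum t
    _ = ((m : ℝ) / 2) * Fval w T := by rw [← Finset.mul_sum, hT.Fval_eq_sum w]
    _ ≤ ((m : ℝ) / 2) * Fval w σA :=
      mul_le_mul_of_nonneg_left ((hopt T hT).trans hσ₂A) (by positivity)
end

section
/- In the instance I(m, D, w, δ) with w > 0 and δ > 0, the maximum of F over feasible schedules on 2 machines equals 2D(w+δ); moreover, the on-time set of every optimal 2-machine schedule is exactly P, the set of the 2D jobs covered by the D disjoint agreement edges. -/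
/-- The instance `I(m, D, wv, δ)`: the job set is `C ∪ P` with `C` and `P`
disjoint, `|C| = mD`, and `P` consisting of `D` disjoint pairs (`|P| = 2D`)
given by the fixed-point-free involution `pair` on `P`. The agreement graph
(the complement of the conflict graph `G` on the job set) is the disjoint union
of the complete graph on `C` and the `D` disjoint edges `{j, pair j}` for
`j ∈ P`. Every job of `C` has weight `wv`, every job of `P` has weight `wv + δ`. -/
structure InstanceI (m D : ℕ) (wv δ : ℝ) (C P : Finset ℕ) (pair : ℕ → ℕ)
    (G : SimpleGraph ℕ) (w : ℕ → ℝ) : Prop where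
  disj : Disjoint C P
  cardC : C.card = m * D
  cardP : P.card = 2 * D
  pair_mem : ∀ j ∈ P, pair j ∈ P
  pair_invol : ∀ j ∈ P, pair (pair j) = j
  pair_ne : ∀ j ∈ P, pair j ≠ j
  adj_iff : ∀ a ∈ C ∪ P, ∀ b ∈ C ∪ P,
    (G.Adj a b ↔ a ≠ b ∧ ¬ ((a ∈ C ∧ b ∈ C) ∨ (a ∈ P ∧ b ∈ P ∧ b = pair a)))
  wC : ∀ j ∈ C, w j = wv
  wP : ∀ j ∈ P, w j = wv + δ

/-- A finite set of size `2 * D` with a fixed-point-free involution splits into `D` orbits. -/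
theorem exists_partition_into_orbits (pair : ℕ → ℕ) (D : ℕ) (P : Finset ℕ)
    (hcard : P.card = 2 * D) (hmem : ∀ j ∈ P, pair j ∈ P)
    (hinv : ∀ j ∈ P, pair (pair j) = j) (hne : ∀ j ∈ P, pair j ≠ j) :
    ∃ S : Fin D → Finset ℕ, (∀ t t' : Fin D, t ≠ t' → Disjoint (S t) (S t')) ∧
      (∀ t, ∃ a ∈ P, S t = {a, pair a}) ∧ Finset.univ.biUnion S = P := by
  induction D generalizing P with
  | zero =>
    have hP : P = ∅ := by simpa using hcard
    subst hP
    exact ⟨fun _ => ∅, fun t => t.elim0, fun t => t.elim0, by simp⟩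
  | succ D ih =>
    obtain ⟨a, ha⟩ : P.Nonempty := by
      rw [← Finset.card_pos]; omega
    have hpa := hmem a ha
    have hna := hne a ha
    have hsub : ({a, pair a} : Finset ℕ) ⊆ P := by
      intro x hx
      simp only [Finset.mem_insert, Finset.mem_singleton] at hx
      rcases hx with rfl | rfl <;> assumption
    obtain ⟨S, hdisj, horb, hunion⟩ := ih (P \ {a, pair a})
      (by
        rw [Finset.card_sdiff_of_subset hsub, Finset.card_pair hna.symm]; omega)
      (by
        intro j hj
        simp only [Finset.mem_sdiff, Finset.mem_insert, Finset.mem_singleton, not_or] at hj ⊢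
        refine ⟨hmem j hj.1, fun h => hj.2.2 ?_, fun h => hj.2.1 ?_⟩
        · rw [← h, hinv j hj.1]
        · rw [← hinv j hj.1, h, hinv a ha])
      (fun j hj => hinv j (Finset.mem_sdiff.1 hj).1)
      (fun j hj => hne j (Finset.mem_sdiff.1 hj).1)
    have hS : ∀ t, Disjoint ({a, pair a} : Finset ℕ) (S t) := fun t =>
      Finset.disjoint_sdiff.mono_right
        (hunion ▸ Finset.subset_biUnion_of_mem S (Finset.mem_univ t))
    refine ⟨Fin.cons {a, pair a} S, ?_, ?_, ?_⟩
    · intro t t' h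
      induction t using Fin.cases with
      | zero =>
        induction t' using Fin.cases with
        | zero => exact absurd rfl h
        | succ t' => simpa only [Fin.cons_zero, Fin.cons_succ] using hS t'
      | succ t =>
        induction t' using Fin.cases with
        | zero => simpa only [Fin.cons_zero, Fin.cons_succ] using (hS t).symm
        | succ t' =>
          simpa only [Fin.cons_succ] using hdisj t t' fun e => h (congrArg Fin.succ e)
    · intro t
      induction t using Fin.cases with
      | zero => exact ⟨a, ha, rfl⟩
      | succ t =>
        obtain ⟨b, hb, h⟩ := horb t
        exact ⟨b, (Finset.mem_sdiff.1 hb).1, h⟩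
    · rw [← Finset.union_sdiff_of_subset hsub, ← hunion]
      ext x
      simp only [Finset.mem_biUnion, Finset.mem_univ, true_and, Fin.exists_fin_succ,
        Fin.cons_zero, Fin.cons_succ, Finset.mem_union]

theorem Feasible.onTime_subset {N : Finset ℕ} {G : SimpleGraph ℕ} {m D : ℕ}
    {S : Fin D → Finset ℕ} (h : Feasible N G m D S) : onTime S ⊆ N :=
  Finset.biUnion_subset.2 fun t _ => h.1 t

theorem Feasible.card_onTime_le {N : Finset ℕ} {G : SimpleGraph ℕ} {m D : ℕ}
    {S : Fin D → Finset ℕ} (h : Feasible N G m D S) : (onTime S).card ≤ D * m := by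
  simpa [onTime] using Finset.card_biUnion_le_card_mul Finset.univ S m fun t _ => h.2.2.1 t

theorem InstanceI.exists_feasible_onTime_eq {m D : ℕ} {wv δ : ℝ} {C P : Finset ℕ}
    {pair : ℕ → ℕ} {G : SimpleGraph ℕ} {w : ℕ → ℝ} (hI : InstanceI m D wv δ C P pair G w) :
    ∃ σ : Fin D → Finset ℕ, Feasible (C ∪ P) G 2 D σ ∧ onTime σ = P := by
  obtain ⟨S, hdisj, horb, hunion⟩ := exists_partition_into_orbits pair D P hI.cardP
    hI.pair_mem hI.pair_invol hI.pair_ne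
  have hSP : ∀ t, S t ⊆ P := fun t =>
    hunion ▸ Finset.subset_biUnion_of_mem S (Finset.mem_univ t)
  refine ⟨S, ⟨fun t => (hSP t).trans Finset.subset_union_right, hdisj, fun t => ?_, ?_⟩, hunion⟩
  · obtain ⟨a, -, h⟩ := horb t
    exact h ▸ Finset.card_le_two
  · intro t x hx y hy hxy
    have hxP := hSP t hx
    have hyP := hSP t hy
    obtain ⟨hne, hn⟩ := (hI.adj_iff x (Finset.mem_union_right _ hxP) y
      (Finset.mem_union_right _ hyP)).1 hxy
    refine hn (Or.inr ⟨hxP, hyP, ?_⟩)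
    obtain ⟨a, ha, h⟩ := horb t
    rw [h, Finset.mem_insert, Finset.mem_singleton] at hx hy
    rcases hx with rfl | rfl <;> rcases hy with rfl | rfl
    · exact absurd rfl hne
    · rfl
    · exact (hI.pair_invol _ ha).symm
    · exact absurd rfl hne

theorem InstanceI.weight_le {m D : ℕ} {wv δ : ℝ} {C P : Finset ℕ}
    {pair : ℕ → ℕ} {G : SimpleGraph ℕ} {w : ℕ → ℝ} (hI : InstanceI m D wv δ C P pair G w)
    (hδ : 0 ≤ δ) {j : ℕ} (hj : j ∈ C ∪ P) : w j ≤ wv + δ := by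
  rcases Finset.mem_union.1 hj with h | h
  · rw [hI.wC j h]; linarith
  · rw [hI.wP j h]

/-- In the instance `I(m, D, wv, δ)` with `wv > 0`, `δ > 0`, the maximum of `F`
over feasible schedules on 2 machines equals `2D(wv+δ)`, and the on-time set of
every optimal 2-machine schedule is exactly `P`. -/
theorem two_machine_optimum_of_instanceI
    (m D : ℕ) (hm : 1 ≤ m) (hD : 1 ≤ D) (wv δ : ℝ) (hwv : 0 < wv) (hδ : 0 < δ)
    (C P : Finset ℕ) (pair : ℕ → ℕ) (G : SimpleGraph ℕ) (w : ℕ → ℝ)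
    (hI : InstanceI m D wv δ C P pair G w) :
    IsGreatest {x : ℝ | ∃ σ : Fin D → Finset ℕ,
        Feasible (C ∪ P) G 2 D σ ∧ Fval w σ = x} (2 * D * (wv + δ)) ∧
    ∀ σ : Fin D → Finset ℕ, Feasible (C ∪ P) G 2 D σ →
      (∀ σ' : Fin D → Finset ℕ, Feasible (C ∪ P) G 2 D σ' → Fval w σ' ≤ Fval w σ) →
      onTime σ = P := by
  have hpos : 0 < wv + δ := by linarith
  have hcard : ∀ σ : Fin D → Finset ℕ, Feasible (C ∪ P) G 2 D σ →
      ((onTime σ).card : ℝ) * (wv + δ) ≤ 2 * D * (wv + δ) := by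
    intro σ hσ
    have h : ((onTime σ).card : ℝ) ≤ D * 2 := mod_cast hσ.card_onTime_le
    gcongr
    linarith
  have hle : ∀ σ : Fin D → Finset ℕ, Feasible (C ∪ P) G 2 D σ →
      Fval w σ ≤ (onTime σ).card * (wv + δ) := by
    intro σ hσ
    rw [← nsmul_eq_mul]
    exact Finset.sum_le_card_nsmul _ _ _ fun j hj => hI.weight_le hδ.le (hσ.onTime_subset hj)
  obtain ⟨τ, hτ, hτP⟩ := hI.exists_feasible_onTime_eq
  have hFτ : Fval w τ = 2 * D * (wv + δ) := by
    rw [Fval, hτP, Finset.sum_congr rfl hI.wP, Finset.sum_const, hI.cardP, nsmul_eq_mul]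
    push_cast
    ring
  refine ⟨⟨⟨τ, hτ, hFτ⟩, ?_⟩, ?_⟩
  · rintro x ⟨σ, hσ, rfl⟩
    exact (hle σ hσ).trans (hcard σ hσ)
  · intro σ hσ hopt
    have hF : 2 * D * (wv + δ) ≤ Fval w σ := hFτ ▸ hopt τ hτ
    have hsub : onTime σ ⊆ P := by
      intro j hj
      by_contra hjP
      have hjC : j ∈ C := (Finset.mem_union.1 (hσ.onTime_subset hj)).resolve_right hjP
      have hlt : Fval w σ < (onTime σ).card * (wv + δ) := by
        rw [← nsmul_eq_mul, ← Finset.sum_const]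
        refine Finset.sum_lt_sum (fun i hi => hI.weight_le hδ.le (hσ.onTime_subset hi))
          ⟨j, hj, ?_⟩
        rw [hI.wC j hjC]
        linarith
      linarith [hcard σ hσ]
    refine Finset.eq_of_subset_of_card_le hsub ?_
    rw [hI.cardP]
    have h := le_of_mul_le_mul_right (hF.trans (hle σ hσ)) hpos
    exact_mod_cast h
end

section
/- In the instance I(m, D, w, δ) with w > 0 and δ > 0, every feasible schedule σ on m machines whose on-time set contains all 2D jobs of P satisfies J(σ) = P and F(σ) = 2D(w+δ). (Each job of P can be processed concurrently only with its partner, so each of the D time slots contains exactly one pair from P and no other job.) -/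
/-- A slot that contains a job of `P` contains at most that job and its partner. -/
theorem Feasible.slot_subset_pair {m D : ℕ} {wv δ : ℝ} {C P : Finset ℕ} {pair : ℕ → ℕ}
    {G : SimpleGraph ℕ} {w : ℕ → ℝ} (hI : InstanceI m D wv δ C P pair G w)
    {σ : Fin D → Finset ℕ} (hσ : Feasible (C ∪ P) G m D σ) {t : Fin D} {j : ℕ}
    (hj : j ∈ σ t) (hjP : j ∈ P) : σ t ⊆ {j, pair j} := by
  intro b hb
  have hnadj := hσ.2.2.2 t j hj b hb
  rw [hI.adj_iff j (hσ.1 t hj) b (hσ.1 t hb)] at hnadj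
  have hjC : j ∉ C := Finset.disjoint_right.mp hI.disj hjP
  simp only [Finset.mem_insert, Finset.mem_singleton]
  grind

/-- Each slot contains at most two jobs of `P`. -/
theorem Feasible.card_slot_inter_le_two {m D : ℕ} {wv δ : ℝ} {C P : Finset ℕ} {pair : ℕ → ℕ}
    {G : SimpleGraph ℕ} {w : ℕ → ℝ} (hI : InstanceI m D wv δ C P pair G w)
    {σ : Fin D → Finset ℕ} (hσ : Feasible (C ∪ P) G m D σ) (t : Fin D) :
    (σ t ∩ P).card ≤ 2 := by
  obtain h | ⟨j, hj⟩ := (σ t ∩ P).eq_empty_or_nonempty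
  · simp [h]
  · obtain ⟨hjt, hjP⟩ := Finset.mem_inter.mp hj
    exact (Finset.card_le_card
      (Finset.inter_subset_left.trans (hσ.slot_subset_pair hI hjt hjP))).trans Finset.card_le_two

/-- If every job of `P` is on time, then every slot contains a job of `P`. -/
theorem Feasible.slot_inter_nonempty {m D : ℕ} {wv δ : ℝ} {C P : Finset ℕ} {pair : ℕ → ℕ}
    {G : SimpleGraph ℕ} {w : ℕ → ℝ} (hI : InstanceI m D wv δ C P pair G w)
    {σ : Fin D → Finset ℕ} (hσ : Feasible (C ∪ P) G m D σ) (hP : P ⊆ onTime σ) (t : Fin D) :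
    (σ t ∩ P).Nonempty := by
  by_contra h
  have hcover : P ⊆ Finset.univ.biUnion fun s => σ s ∩ P := by
    rw [← Finset.biUnion_inter]
    exact Finset.subset_inter hP Finset.Subset.rfl
  have hle : P.card ≤ ∑ s, (σ s ∩ P).card :=
    (Finset.card_le_card hcover).trans Finset.card_biUnion_le
  have hlt : ∑ s, (σ s ∩ P).card < ∑ _s : Fin D, 2 :=
    Finset.sum_lt_sum (fun s _ => hσ.card_slot_inter_le_two hI s)
      ⟨t, Finset.mem_univ t, by simp [Finset.not_nonempty_iff_eq_empty.mp h]⟩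
  have hcard := hI.cardP
  simp only [Finset.sum_const, Finset.card_univ, Fintype.card_fin, smul_eq_mul] at hlt
  omega

/-- In the instance `I(m, D, wv, δ)` with `wv > 0`, `δ > 0`, every feasible
schedule `σ` on `m` machines whose on-time set contains all `2D` jobs of `P`
satisfies `J(σ) = P` and `F(σ) = 2D(wv+δ)`. -/
theorem onTime_eq_P_of_instanceI
    (m D : ℕ) (hm : 1 ≤ m) (hD : 1 ≤ D) (wv δ : ℝ) (hwv : 0 < wv) (hδ : 0 < δ)
    (C P : Finset ℕ) (pair : ℕ → ℕ) (G : SimpleGraph ℕ) (w : ℕ → ℝ)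
    (hI : InstanceI m D wv δ C P pair G w)
    (σ : Fin D → Finset ℕ) (hσ : Feasible (C ∪ P) G m D σ)
    (hP : P ⊆ onTime σ) :
    onTime σ = P ∧ Fval w σ = 2 * D * (wv + δ) := by
  have honTime : onTime σ = P := by
    refine Finset.Subset.antisymm (Finset.biUnion_subset.mpr fun t _ => ?_) hP
    obtain ⟨j, hj⟩ := hσ.slot_inter_nonempty hI hP t
    obtain ⟨hjt, hjP⟩ := Finset.mem_inter.mp hj
    refine (hσ.slot_subset_pair hI hjt hjP).trans ?_
    simp [Finset.insert_subset_iff, hjP, hI.pair_mem j hjP]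
  refine ⟨honTime, ?_⟩
  rw [Fval, honTime, Finset.sum_congr rfl hI.wP, Finset.sum_const, hI.cardP, nsmul_eq_mul]
  push_cast
  ring
end

section
/- In the instance I(m, D, w, δ) with w > 0, δ > 0 and 2(w+δ) < mw, the maximum of F over feasible schedules on m machines equals mwD; it is attained by a schedule whose D time slots partition C into D sets of m jobs each. -/
/-- A finset of cardinality `m * D` splits into `D` pairwise disjoint blocks of size `m`. -/
theorem exists_equal_blocks {α : Type*} [DecidableEq α] {m D : ℕ} {C : Finset α}
    (hC : C.card = m * D) :
    ∃ σ : Fin D → Finset α, (∀ t, σ t ⊆ C ∧ (σ t).card = m) ∧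
      (∀ t t', t ≠ t' → Disjoint (σ t) (σ t')) ∧ Finset.univ.biUnion σ = C := by
  have e : C ≃ Fin D × Fin m := Fintype.equivOfCardEq (by simp [hC, mul_comm])
  refine ⟨fun t => Finset.univ.image fun i => (e.symm (t, i) : α), fun t => ⟨?_, ?_⟩, ?_, ?_⟩
  · intro x hx
    obtain ⟨i, -, rfl⟩ := Finset.mem_image.1 hx
    exact (e.symm (t, i)).2
  · rw [Finset.card_image_of_injective]
    · simp
    · intro i j hij
      simpa using e.symm.injective (Subtype.ext hij)
  · intro t t' htt'
    rw [Finset.disjoint_left]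
    intro x hx hx'
    obtain ⟨i, -, rfl⟩ := Finset.mem_image.1 hx
    obtain ⟨j, -, hij⟩ := Finset.mem_image.1 hx'
    exact htt' (Prod.ext_iff.1 (e.symm.injective (Subtype.ext hij))).1.symm
  · ext x
    simp only [Finset.mem_biUnion, Finset.mem_univ, Finset.mem_image, true_and]
    constructor
    · rintro ⟨t, i, rfl⟩
      exact (e.symm (t, i)).2
    · intro hx
      exact ⟨(e ⟨x, hx⟩).1, (e ⟨x, hx⟩).2, by simp⟩

/-- A conflict-free set containing a job `a` of `P` is contained in the pair of `a`. -/
theorem InstanceI.subset_pair {m D : ℕ} {wv δ : ℝ} {C P : Finset ℕ} {pair : ℕ → ℕ}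
    {G : SimpleGraph ℕ} {w : ℕ → ℝ} (hI : InstanceI m D wv δ C P pair G w)
    {A : Finset ℕ} (hA : A ⊆ C ∪ P) (hind : ∀ a ∈ A, ∀ b ∈ A, ¬ G.Adj a b)
    {a : ℕ} (haA : a ∈ A) (haP : a ∈ P) : A ⊆ {a, pair a} := by
  intro b hb
  have haC : a ∉ C := Finset.disjoint_right.1 hI.disj haP
  have h := hind a haA b hb
  rw [hI.adj_iff a (hA haA) b (hA hb)] at h
  simp only [Finset.mem_insert, Finset.mem_singleton]
  tauto

/-- Every conflict-free set of at most `m` jobs has weight at most `m * wv`. -/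
theorem InstanceI.sum_le {m D : ℕ} {wv δ : ℝ} {C P : Finset ℕ} {pair : ℕ → ℕ}
    {G : SimpleGraph ℕ} {w : ℕ → ℝ} (hI : InstanceI m D wv δ C P pair G w)
    (hwv : 0 ≤ wv) (hδ : 0 ≤ δ) (hle : 2 * (wv + δ) ≤ m * wv)
    {A : Finset ℕ} (hA : A ⊆ C ∪ P) (hcard : A.card ≤ m)
    (hind : ∀ a ∈ A, ∀ b ∈ A, ¬ G.Adj a b) : ∑ j ∈ A, w j ≤ m * wv := by
  by_cases h : ∃ a ∈ A, a ∈ P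
  · obtain ⟨a, haA, haP⟩ := h
    have hsub := hI.subset_pair hA hind haA haP
    have hw : ∀ j ∈ A, w j ≤ wv + δ := by
      intro j hj
      refine (hI.wP j ?_).le
      have hj' := hsub hj
      simp only [Finset.mem_insert, Finset.mem_singleton] at hj'
      rcases hj' with rfl | rfl
      · exact haP
      · exact hI.pair_mem a haP
    have hA2 : (A.card : ℝ) ≤ 2 := by
      exact_mod_cast (Finset.card_le_card hsub).trans Finset.card_le_two
    calc ∑ j ∈ A, w j ≤ A.card * (wv + δ) := by
          simpa only [nsmul_eq_mul] using Finset.sum_le_card_nsmul A w (wv + δ) hw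
      _ ≤ 2 * (wv + δ) := by gcongr
      _ ≤ m * wv := hle
  · have hw : ∀ j ∈ A, w j ≤ wv := by
      intro j hj
      rcases Finset.mem_union.1 (hA hj) with hC | hP
      · exact (hI.wC j hC).le
      · exact absurd ⟨j, hj, hP⟩ h
    calc ∑ j ∈ A, w j ≤ A.card * wv := by
          simpa only [nsmul_eq_mul] using Finset.sum_le_card_nsmul A w wv hw
      _ ≤ m * wv := by gcongr

/-- The total weight of a feasible schedule is the sum of the weights of its slots. -/
theorem Feasible.Fval_eq {N : Finset ℕ} {G : SimpleGraph ℕ} {m D : ℕ}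
    {σ : Fin D → Finset ℕ} (hσ : Feasible N G m D σ) (w : ℕ → ℝ) :
    Fval w σ = ∑ t, ∑ j ∈ σ t, w j :=
  Finset.sum_biUnion fun t _ t' _ htt' => hσ.2.1 t t' htt'

/-- In the instance `I(m, D, wv, δ)` with `wv > 0`, `δ > 0` and
`2(wv+δ) < m·wv`, the maximum of `F` over feasible schedules on `m` machines
equals `m·wv·D`; it is attained by a schedule whose `D` time slots partition `C`
into `D` sets of `m` jobs each. -/
theorem m_machine_optimum_of_instanceI
    (m D : ℕ) (hm : 1 ≤ m) (hD : 1 ≤ D) (wv δ : ℝ) (hwv : 0 < wv) (hδ : 0 < δ)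
    (C P : Finset ℕ) (pair : ℕ → ℕ) (G : SimpleGraph ℕ) (w : ℕ → ℝ)
    (hI : InstanceI m D wv δ C P pair G w)
    (hlt : 2 * (wv + δ) < m * wv) :
    IsGreatest {x : ℝ | ∃ σ : Fin D → Finset ℕ,
        Feasible (C ∪ P) G m D σ ∧ Fval w σ = x} (m * wv * D) ∧
    ∃ σ : Fin D → Finset ℕ, Feasible (C ∪ P) G m D σ ∧
      (∀ t, σ t ⊆ C ∧ (σ t).card = m) ∧ onTime σ = C ∧
      Fval w σ = m * wv * D := by
  obtain ⟨σ, hσC, hσd, hσU⟩ := exists_equal_blocks hI.cardC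
  have hfeas : Feasible (C ∪ P) G m D σ := by
    refine ⟨fun t => (hσC t).1.trans Finset.subset_union_left, hσd, fun t => (hσC t).2.le, ?_⟩
    intro t a ha b hb
    have haC := (hσC t).1 ha
    have hbC := (hσC t).1 hb
    rw [hI.adj_iff a (Finset.mem_union_left P haC) b (Finset.mem_union_left P hbC)]
    exact fun h => h.2 (Or.inl ⟨haC, hbC⟩)
  have hval : Fval w σ = m * wv * D := by
    rw [Fval, onTime, hσU, Finset.sum_congr rfl hI.wC, Finset.sum_const, hI.cardC, nsmul_eq_mul]
    push_cast
    ring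
  refine ⟨⟨⟨σ, hfeas, hval⟩, ?_⟩, σ, hfeas, hσC, hσU, hval⟩
  rintro x ⟨τ, hτ, rfl⟩
  rw [hτ.Fval_eq w]
  calc ∑ t, ∑ j ∈ τ t, w j ≤ ∑ _t : Fin D, m * wv :=
        Finset.sum_le_sum fun t _ =>
          hI.sum_le hwv.le hδ.le hlt.le (hτ.1 t) (hτ.2.2.1 t) (hτ.2.2.2 t)
    _ = m * wv * D := by simp [mul_comm]
end

section
/- Let m ≥ 2 be an integer, let S be a finite set with |S| ≤ m and 2 ≤ |S|, and let w : S → ℝ be nonnegative. Let a be an element of S of maximum weight and let b be an element of S \ {a} of maximum weight among S \ {a}. Then Σ_{j ∈ S} w_j ≤ w_a + w_b + (m − 2)·u, where u is the third largest weight in S (u = 0 if |S| = 2), and consequently Σ_{j ∈ S} w_j ≤ (m/2)·(w_a + w_b). -/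
/-- The per-time-slot inequality in the proof of the `m/2` performance
guarantee. Let `S` be a finite set with `2 ≤ |S| ≤ m` (`m ≥ 2` an integer) with
nonnegative weights `w`, let `a` be an element of `S` of maximum weight, `b` an
element of `S \ {a}` of maximum weight among `S \ {a}`, and let `u` be the third
largest weight (`u = 0` if `|S| = 2`, and `u` is the maximum weight on
`S \ {a, b}` if `|S| ≥ 3`). Then `∑_{j ∈ S} w j ≤ w a + w b + (m - 2)·u`, and
consequently `∑_{j ∈ S} w j ≤ (m/2)·(w a + w b)`. -/
theorem slot_weight_le_half_m_two_heaviest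
    {α : Type*} [DecidableEq α] (m : ℕ) (hm : 2 ≤ m)
    (S : Finset α) (hSm : S.card ≤ m) (hS2 : 2 ≤ S.card)
    (w : α → ℝ) (hw : ∀ j ∈ S, 0 ≤ w j)
    (a : α) (ha : a ∈ S) (hamax : ∀ j ∈ S, w j ≤ w a)
    (b : α) (hb : b ∈ S.erase a) (hbmax : ∀ j ∈ S.erase a, w j ≤ w b)
    (u : ℝ)
    (hu2 : S.card = 2 → u = 0)
    (hu3 : 3 ≤ S.card →
      (∃ c ∈ (S.erase a).erase b, u = w c) ∧
      ∀ j ∈ (S.erase a).erase b, w j ≤ u) :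
    (∑ j ∈ S, w j ≤ w a + w b + ((m : ℝ) - 2) * u) ∧
    (∑ j ∈ S, w j ≤ ((m : ℝ) / 2) * (w a + w b)) := by
  have hsum : w a + (w b + ∑ j ∈ (S.erase a).erase b, w j) = ∑ j ∈ S, w j := by
    rw [Finset.add_sum_erase _ _ hb, Finset.add_sum_erase _ _ ha]
  have hcard : ((S.erase a).erase b).card + 2 = S.card := by
    rw [Finset.card_erase_of_mem hb, Finset.card_erase_of_mem ha]
    omega
  have hwb : 0 ≤ w b := hw b (Finset.mem_of_mem_erase hb)
  have hba : w b ≤ w a := hamax b (Finset.mem_of_mem_erase hb)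
  obtain ⟨hu0, hub, hle⟩ : 0 ≤ u ∧ u ≤ w b ∧ ∀ j ∈ (S.erase a).erase b, w j ≤ u := by
    rcases hS2.eq_or_lt with h | h
    · have hempty : (S.erase a).erase b = ∅ := Finset.card_eq_zero.mp (by omega)
      simp [hu2 h.symm, hwb, hempty]
    · obtain ⟨⟨c, hc, rfl⟩, hmax⟩ := hu3 h
      have hca := Finset.mem_of_mem_erase hc
      exact ⟨hw c (Finset.mem_of_mem_erase hca), hbmax c hca, hmax⟩
  have hrest := Finset.sum_le_card_nsmul _ w u hle
  rw [nsmul_eq_mul] at hrest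
  have hcardm : (((S.erase a).erase b).card : ℝ) ≤ (m : ℝ) - 2 := by
    rw [le_sub_iff_add_le]
    exact_mod_cast hcard.trans_le hSm
  have hfirst : ∑ j ∈ S, w j ≤ w a + w b + ((m : ℝ) - 2) * u := by
    linarith [mul_le_mul_of_nonneg_right hcardm hu0]
  have hm' : (0 : ℝ) ≤ (m : ℝ) - 2 := sub_nonneg.mpr (by exact_mod_cast hm)
  have havg : u ≤ (w a + w b) / 2 := by linarith
  exact ⟨hfirst, by linarith [mul_le_mul_of_nonneg_left havg hm']⟩
end
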